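/- The number of monotone Boolean functions of 8 variables that are fixed points of the permutation of Fin 8 given by the product of transpositions (0 1)(2 3)(4 5)(6 7) equals 2038188253420. -/

import Mathlib

/-- Evaluates `n` to a numeral before passing it on to `k`. -/
noncomputable def force (n : ℕ) (k : ℕ → ℕ) : ℕ :=
  Nat.rec (k 0) (fun m _ => k (Nat.succ m)) n

/-- The sum of `φ` over a list, in a form that the kernel evaluates quickly. -/
noncomputable def listSum (l : List ℕ) (φ : ℕ → ℕ) : ℕ :=
  List.rec 0 (fun x _ s => Nat.add (force x φ) s) l

/-- The truth tables of the monotone Boolean functions of four variables. -/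
def codes : List ℕ :=
  [0, 32768, 32896, 34816, 34944, 34952, 40960, 41088, 41120, 43008, 43136, 43144, 43168,
   43176, 43520, 43648, 43656, 43680, 43688, 43690, 49152, 49280, 49344, 51200, 51328, 51336,
   51392, 51400, 52224, 52352, 52360, 52416, 52424, 52428, 57344, 57472, 57504, 57536, 57568,
   59392, 59520, 59528, 59552, 59560, 59584, 59592, 59616, 59624, 59904, 60032, 60040, 60064,
   60072, 60074, 60096, 60104, 60128, 60136, 60138, 60416, 60544, 60552, 60576, 60584, 60608,
   60616, 60620, 60640, 60648, 60652, 60928, 61056, 61064, 61088, 61096, 61098, 61120, 61128,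
   61132, 61152, 61160, 61162, 61164, 61166, 61440, 61568, 61600, 61632, 61664, 61680, 63488,
   63616, 63624, 63648, 63656, 63680, 63688, 63712, 63720, 63728, 63736, 64000, 64128, 64136,
   64160, 64168, 64170, 64192, 64200, 64224, 64232, 64234, 64240, 64248, 64250, 64512, 64640,
   64648, 64672, 64680, 64704, 64712, 64716, 64736, 64744, 64748, 64752, 64760, 64764, 65024,
   65152, 65160, 65184, 65192, 65194, 65216, 65224, 65228, 65248, 65256, 65258, 65260, 65262,
   65264, 65272, 65274, 65276, 65278, 65280, 65408, 65416, 65440, 65448, 65450, 65472, 65480,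
   65484, 65504, 65512, 65514, 65516, 65518, 65520, 65528, 65530, 65532, 65534, 65535]

/-- The truth tables of those functions that are fixed by `swapPairs`. -/
def fixedCodes : List ℕ :=
  [0, 32768, 34944, 34952, 57344, 59520, 59528, 60096, 60104, 60576, 60584, 61152, 61160,
   61166, 61440, 63616, 63624, 64192, 64200, 64672, 64680, 65248, 65256, 65262, 65520, 65528,
   65534, 65535]

/-- `x` if the bits of `a` are among those of `b`, and `0` otherwise. -/
noncomputable def ifLe (a b x : ℕ) : ℕ :=
  cond (Nat.beq (Nat.land a b) a) x 0

/-- The position of `c` among the fixed codes. -/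
noncomputable def rank (c : ℕ) : ℕ :=
  listSum fixedCodes fun x => cond (Nat.blt x c) 1 0

/-- The action of swapping `0, 1` and `2, 3` on truth tables. -/
noncomputable def swapCode (x : ℕ) : ℕ :=
  force (Nat.lor (Nat.land x 39321)
    (Nat.lor (Nat.shiftLeft (Nat.land x 8738) 1) (Nat.shiftRight (Nat.land x 17476) 1))) fun y =>
  Nat.lor (Nat.land y 61455)
    (Nat.lor (Nat.shiftLeft (Nat.land y 240) 4) (Nat.shiftRight (Nat.land y 3840) 4))

/-- The sum of `u c` over the fixed codes `c` below `e`. -/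
noncomputable def lowSum (u : ℕ → ℕ) (e : ℕ) : ℕ :=
  listSum fixedCodes fun c => ifLe c e (u c)

/-- The sum of `v d` over the fixed codes `d` above `e`. -/
noncomputable def highSum (v : ℕ → ℕ) (e : ℕ) : ℕ :=
  listSum fixedCodes fun d => ifLe e d (v d)

/-- The sum of `u c` over the chains `c ≤ e ≤ x` of codes with `c` fixed. -/
noncomputable def lowChainSum (u : ℕ → ℕ) (x : ℕ) : ℕ :=
  listSum codes fun e => ifLe e x (lowSum u e)

/-- The sum of `v d` over the chains `x ≤ e ≤ d` of codes with `d` fixed. -/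
noncomputable def highChainSum (v : ℕ → ℕ) (x : ℕ) : ℕ :=
  listSum codes fun e => ifLe x e (highSum v e)

/-- The sum of `u c * v d` over the chains `c ≤ e ≤ h ≤ e' ≤ d` of codes with `c`, `h`, `d` fixed,
`e ≤ x` and `y ≤ e'`. -/
noncomputable def chainSum (u v : ℕ → ℕ) (x y : ℕ) : ℕ :=
  listSum fixedCodes fun h =>
    Nat.mul (force (Nat.land h x) (lowChainSum u)) (force (Nat.lor h y) (highChainSum v))

/-- The weight of `c` that puts it at its rank, in blocks of `w` bits. -/
noncomputable def weight (w c : ℕ) : ℕ := Nat.pow 2 (Nat.mul w (rank c))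

/-- The weight of `c` that puts it at its rank from the end, in blocks of `w` bits. -/
noncomputable def coweight (w c : ℕ) : ℕ := Nat.pow 2 (Nat.mul w (Nat.sub 27 (rank c)))

/-- The number of functions whose middle slices have codes `m` and `n`, where `n'` is the code of
the swapped second slice: the product of two polynomials at `2 ^ 64` has it as a digit. -/
noncomputable def sliceCount (m n n' : ℕ) : ℕ :=
  Nat.mod (Nat.shiftRight (Nat.mul
    (force (Nat.land m n') fun x => force (Nat.lor m n) fun y =>
      chainSum (weight 1792) (weight 64) x y)
    (force (Nat.land m n) fun x => force (Nat.lor m n') fun y =>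
      chainSum (coweight 1792) (coweight 64) x y)) 50112) 18446744073709551616

/-- The number of functions, as the sum over the middle slices. -/
noncomputable def totalCount : ℕ :=
  listSum codes fun m => listSum codes fun n => force (swapCode n) fun n' => sliceCount m n n'

theorem force_eq (n : ℕ) (k : ℕ → ℕ) : force n k = k n := by cases n <;> rfl

theorem listSum_eq (l : List ℕ) (φ : ℕ → ℕ) : listSum l φ = (l.map φ).sum := by
  induction l with
  | nil => rfl
  | cons x l ih =>
    rw [List.map_cons, List.sum_cons, ← ih, ← force_eq x φ]
    rfl

theorem ifLe_eq (a b x : ℕ) : ifLe a b x = if a &&& b = a then x else 0 := by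
  change cond (Nat.beq (a &&& b) a) x 0 = _
  split_ifs with h
  · rw [h, Nat.beq_refl]; rfl
  · rw [Bool.eq_false_iff.mpr (mt Nat.eq_of_beq_eq_true h)]; rfl

theorem swapCode_eq (x : ℕ) : swapCode x =
    (fun y => y &&& 61455 ||| ((y &&& 240) <<< 4 ||| (y &&& 3840) >>> 4))
      (x &&& 39321 ||| ((x &&& 8738) <<< 1 ||| (x &&& 17476) >>> 1)) :=
  force_eq _ _

theorem weight_eq (w c : ℕ) : weight w c = 2 ^ (w * rank c) := rfl

theorem coweight_eq (w c : ℕ) : coweight w c = 2 ^ (w * (27 - rank c)) := rfl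

theorem sliceCount_eq (m n n' : ℕ) : sliceCount m n n' =
    (chainSum (weight 1792) (weight 64) (m &&& n') (m ||| n) *
      chainSum (coweight 1792) (coweight 64) (m &&& n) (m ||| n')) >>> 50112 %
      18446744073709551616 := by
  simp only [sliceCount, force_eq]
  rfl

theorem totalCount_eq : totalCount =
    listSum codes fun m => listSum codes fun n => sliceCount m n (swapCode n) := by
  simp only [totalCount, force_eq]

theorem land_eq_left_iff (a b : ℕ) : a &&& b = a ↔ ∀ i, a.testBit i = true → b.testBit i = true := by
  rw [Nat.eq_iff_testBit_eq]
  simp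

theorem land_land_eq_left_iff (a b c : ℕ) :
    a &&& (b &&& c) = a ↔ a &&& b = a ∧ a &&& c = a := by
  simp only [land_eq_left_iff, Nat.testBit_and, Bool.and_eq_true]
  exact ⟨fun h => ⟨fun i hi => (h i hi).1, fun i hi => (h i hi).2⟩,
    fun h i hi => ⟨h.1 i hi, h.2 i hi⟩⟩

theorem lor_land_eq_left_iff (a b c : ℕ) :
    (a ||| b) &&& c = a ||| b ↔ a &&& c = a ∧ b &&& c = b := by
  simp only [land_eq_left_iff, Nat.testBit_or, Bool.or_eq_true]
  exact ⟨fun h => ⟨fun i hi => h i (.inl hi), fun i hi => h i (.inr hi)⟩,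
    fun h i hi => hi.elim (h.1 i) (h.2 i)⟩

/-- The numbers of `k` bits that are monotone with respect to the inclusion of binary digits. -/
def monotoneCodes : ℕ → List ℕ
  | 0 => [0]
  | k + 1 => ((monotoneCodes k).flatMap fun x => [x, x + 2 ^ k]).filter fun x =>
      ∀ j < k, j &&& k = j → x.testBit j ≤ x.testBit k

/-- The monotone Boolean functions of four variables. -/
abbrev MonotoneFour : Type := {g : (Fin 4 → Bool) → Bool // Monotone g}

namespace MonotoneFour

/-- The function with the arguments `0, 1` and `2, 3` swapped. -/
def swapPairs (g : MonotoneFour) : MonotoneFour :=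
  ⟨fun x => g.1 ![x 1, x 0, x 3, x 2], fun x y h => g.2 fun i => by fin_cases i <;> exact h _⟩

theorem swapPairs_swapPairs (g : MonotoneFour) : g.swapPairs.swapPairs = g := by
  refine Subtype.ext (funext fun x => congrArg g.1 (funext fun i => ?_))
  fin_cases i <;> rfl

theorem swapPairs_le_swapPairs {g h : MonotoneFour} (H : g ≤ h) : g.swapPairs ≤ h.swapPairs :=
  fun _ => H _

theorem le_swapPairs_of_swapPairs_le {g h : MonotoneFour} (H : g.swapPairs ≤ h) :
    g ≤ h.swapPairs := by
  rw [← g.swapPairs_swapPairs]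
  exact swapPairs_le_swapPairs H

/-- The truth table of a function, as a number of 16 bits. -/
def code (g : MonotoneFour) : ℕ :=
  Nat.ofBits fun i : Fin 16 => g.1 fun k => i.1.testBit k

theorem testBit_code (g : MonotoneFour) {i : ℕ} (hi : i < 16) :
    g.code.testBit i = g.1 fun k => i.testBit k :=
  Nat.testBit_ofBits_lt _ _ hi

theorem testBit_code_of_le (g : MonotoneFour) {i : ℕ} (hi : 16 ≤ i) : g.code.testBit i = false :=
  Nat.testBit_ofBits_ge _ _ hi

theorem code_lt (g : MonotoneFour) : g.code < 2 ^ 16 := Nat.ofBits_lt_two_pow _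

theorem exists_testBit_eq (x : Fin 4 → Bool) : ∃ i < 16, x = fun k : Fin 4 => i.testBit k := by
  refine ⟨Nat.ofBits x, Nat.ofBits_lt_two_pow x, ?_⟩
  ext k
  rw [Nat.testBit_ofBits_lt]

theorem code_land_code_eq_iff (g h : MonotoneFour) : g.code &&& h.code = g.code ↔ g ≤ h := by
  rw [land_eq_left_iff]
  constructor
  · intro H x
    obtain ⟨i, hi, rfl⟩ := exists_testBit_eq x
    have := H i
    rwa [testBit_code _ hi, testBit_code _ hi] at this
  · intro H i
    rcases lt_or_ge i 16 with hi | hi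
    · rw [testBit_code _ hi, testBit_code _ hi]
      exact H _
    · simp [testBit_code_of_le _ hi]

theorem code_injective : Function.Injective code := fun g h H =>
  le_antisymm ((code_land_code_eq_iff g h).mp (by rw [H, Nat.and_self]))
    ((code_land_code_eq_iff h g).mp (by rw [H, Nat.and_self]))

theorem testBit_swapCode (x : ℕ) {i : ℕ} (hi : i < 16) : (swapCode x).testBit i =
    x.testBit (Nat.ofBits ![i.testBit 1, i.testBit 0, i.testBit 3, i.testBit 2]) := by
  rw [swapCode_eq]
  simp only [Nat.testBit_or, Nat.testBit_and, Nat.testBit_shiftLeft, Nat.testBit_shiftRight]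
  generalize x.testBit = f
  interval_cases i <;> (conv_lhs => simp [Nat.testBit]) <;> rfl

theorem swapCode_lt (x : ℕ) : swapCode x < 2 ^ 16 := by
  rw [swapCode_eq]
  refine Nat.or_lt_two_pow (Nat.and_lt_two_pow _ (by norm_num)) (Nat.or_lt_two_pow ?_ ?_)
  · rw [Nat.shiftLeft_eq]
    exact Nat.mul_lt_mul_of_pos_right (Nat.and_lt_two_pow (n := 12) _ (by norm_num)) (by norm_num)
  · exact (Nat.shiftRight_le _ _).trans_lt (Nat.and_lt_two_pow _ (by norm_num))

theorem swapCode_code (g : MonotoneFour) : swapCode g.code = g.swapPairs.code := by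
  refine Nat.eq_of_testBit_eq fun i => ?_
  rcases lt_or_ge i 16 with hi | hi
  · rw [testBit_swapCode _ hi, testBit_code _ (Nat.ofBits_lt_two_pow _), testBit_code _ hi]
    refine congrArg g.1 (funext fun k => ?_)
    rw [Nat.testBit_ofBits_lt _ _ k.2]
    rfl
  · rw [testBit_code_of_le _ hi, Nat.testBit_lt_two_pow]
    exact (swapCode_lt _).trans_le (Nat.pow_le_pow_right two_pos hi)

theorem code_mem_codes (g : MonotoneFour) : g.code ∈ codes := by
  have key : ∀ k ≤ 16, g.code % 2 ^ k ∈ monotoneCodes k := by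
    intro k
    induction k with
    | zero => simp [monotoneCodes, Nat.mod_one]
    | succ k ih =>
      intro hk
      refine List.mem_filter.mpr ⟨List.mem_flatMap.mpr ⟨_, ih (by omega), ?_⟩, ?_⟩
      · rw [Nat.mod_pow_succ]
        rcases Nat.mod_two_eq_zero_or_one (g.code / 2 ^ k) with h | h <;> simp [h]
      · refine decide_eq_true fun j hj hjk => ?_
        rw [Nat.testBit_mod_two_pow, Nat.testBit_mod_two_pow, decide_eq_true (by omega : j < k + 1),
          decide_eq_true (by omega : k < k + 1), Bool.true_and, Bool.true_and,
          testBit_code _ (by omega), testBit_code _ (by omega)]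
        exact g.2 fun i => (land_eq_left_iff j k).mp hjk i
  have H : ∀ x ∈ monotoneCodes 16, x ∈ codes := by decide +kernel
  rw [← Nat.mod_eq_of_lt g.code_lt]
  exact H _ (key 16 le_rfl)

theorem exists_code_eq {x : ℕ} (hx : x ∈ codes) : ∃ g : MonotoneFour, g.code = x := by
  have H : ∀ x ∈ codes, x < 2 ^ 16 ∧ ∀ i < 16, ∀ j < 16, i &&& j = i →
      x.testBit i ≤ x.testBit j := by
    decide +kernel
  obtain ⟨hlt, hmono⟩ := H x hx
  refine ⟨⟨fun y => x.testBit (Nat.ofBits y), fun y z hyz => ?_⟩, ?_⟩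
  · refine hmono _ (Nat.ofBits_lt_two_pow y) _ (Nat.ofBits_lt_two_pow z)
      ((land_eq_left_iff _ _).mpr fun i => ?_)
    rcases lt_or_ge i 4 with hi | hi
    · rw [Nat.testBit_ofBits_lt y i hi, Nat.testBit_ofBits_lt z i hi]
      exact hyz _
    · simp [Nat.testBit_ofBits_ge y i hi]
  · refine Nat.eq_of_testBit_eq fun i => ?_
    rcases lt_or_ge i 16 with hi | hi
    · rw [testBit_code _ hi]
      change x.testBit (Nat.ofBits _) = _
      congr 1
      refine Nat.eq_of_testBit_eq fun k => ?_
      rcases lt_or_ge k 4 with hk | hk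
      · rw [Nat.testBit_ofBits_lt _ k hk]
      · rw [Nat.testBit_ofBits_ge _ k hk, Nat.testBit_lt_two_pow]
        exact hi.trans_le (Nat.pow_le_pow_right two_pos hk)
    · rw [testBit_code_of_le _ hi, Nat.testBit_lt_two_pow]
      exact hlt.trans_le (Nat.pow_le_pow_right two_pos hi)

noncomputable instance : Fintype MonotoneFour := Fintype.ofFinite _

theorem listSum_codes (φ : ℕ → ℕ) : listSum codes φ = ∑ g : MonotoneFour, φ g.code := by
  have hnodup : codes.Nodup := by decide +kernel
  have himage : codes.toFinset = Finset.univ.image code := by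
    ext x
    simp only [List.mem_toFinset, Finset.mem_image, Finset.mem_univ, true_and]
    exact ⟨exists_code_eq, fun ⟨g, hg⟩ => hg ▸ g.code_mem_codes⟩
  rw [listSum_eq, ← List.sum_toFinset φ hnodup, himage,
    Finset.sum_image fun _ _ _ _ h => code_injective h]

end MonotoneFour

/-- The monotone Boolean functions of four variables that are fixed by `swapPairs`. -/
abbrev FixedFour : Type := {g : MonotoneFour // g.swapPairs = g}

namespace FixedFour

noncomputable instance : Fintype FixedFour := Fintype.ofFinite _

theorem fixedCodes_eq : fixedCodes = codes.filter fun x => swapCode x = x := by decide +kernel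

theorem swapCode_code_eq_iff (g : MonotoneFour) : swapCode g.code = g.code ↔ g.swapPairs = g := by
  rw [MonotoneFour.swapCode_code, MonotoneFour.code_injective.eq_iff]

theorem code_mem_fixedCodes (g : FixedFour) : g.1.code ∈ fixedCodes := by
  rw [fixedCodes_eq, List.mem_filter]
  exact ⟨g.1.code_mem_codes, decide_eq_true ((swapCode_code_eq_iff g.1).mpr g.2)⟩

theorem listSum_fixedCodes (φ : ℕ → ℕ) : listSum fixedCodes φ = ∑ g : FixedFour, φ g.1.code := by
  classical
  have H : listSum fixedCodes φ = listSum codes fun x => if swapCode x = x then φ x else 0 := by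
    rw [listSum_eq, listSum_eq, fixedCodes_eq]
    simp only [List.sum_map_ite, List.map_const', List.sum_replicate, smul_zero, add_zero]
  rw [H, MonotoneFour.listSum_codes]
  simp only [swapCode_code_eq_iff]
  rw [← Finset.sum_filter, Finset.sum_subtype _ (fun g => Finset.mem_filter_univ g)]

theorem swapPairs_eq (g : FixedFour) : g.1.swapPairs = g.1 := g.2

theorem le_swapPairs (g : FixedFour) {h : MonotoneFour} (H : g.1 ≤ h) :
    g.1 ≤ h.swapPairs :=
  MonotoneFour.le_swapPairs_of_swapPairs_le (g.swapPairs_eq.trans_le H)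

theorem rank_le (g : FixedFour) : rank g.1.code ≤ 27 := by
  have H : ∀ c ∈ fixedCodes, rank c ≤ 27 := by decide +kernel
  exact H _ g.code_mem_fixedCodes

theorem rank_injective : Function.Injective fun g : FixedFour => rank g.1.code := by
  have H : ∀ c ∈ fixedCodes, ∀ d ∈ fixedCodes, rank c = rank d → c = d := by decide +kernel
  exact fun g h e => Subtype.ext (MonotoneFour.code_injective
    (H _ g.code_mem_fixedCodes _ h.code_mem_fixedCodes e))

end FixedFour

/-- A product of two polynomials at `B` has the number of pairs of terms with given exponents as a
digit. -/
theorem sum_pow_mul_sum_pow_digit {α β : Type*} (S : Finset α) (T : Finset β) (e : α → ℕ)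
    (e' : β → ℕ) (K B : ℕ) (he' : ∀ t ∈ T, e' t ≤ K) (hcard : S.card * T.card < B) :
    (∑ s ∈ S, B ^ e s) * (∑ t ∈ T, B ^ (K - e' t)) / B ^ K % B =
      ((S ×ˢ T).filter fun p => e p.1 = e' p.2).card := by
  have hB : 0 < B := by omega
  set P := S ×ˢ T with hP
  have hsplit : (∑ s ∈ S, B ^ e s) * (∑ t ∈ T, B ^ (K - e' t)) =
      (∑ p ∈ P with e p.1 < e' p.2, B ^ (e p.1 + (K - e' p.2))) +
      B ^ K * ((P.filter fun p => e p.1 = e' p.2).card +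
        B * ∑ p ∈ P with e' p.2 < e p.1, B ^ (e p.1 - e' p.2 - 1)) := by
    rw [Finset.sum_mul_sum, ← Finset.sum_product', ← hP, Finset.card_filter, Finset.sum_filter,
      Finset.sum_filter, Finset.mul_sum, ← Finset.sum_add_distrib, Finset.mul_sum,
      ← Finset.sum_add_distrib]
    refine Finset.sum_congr rfl fun p hp => ?_
    have := he' p.2 (Finset.mem_product.mp hp).2
    rw [← pow_add]
    rcases lt_trichotomy (e p.1) (e' p.2) with h | h | h
    · simp [h, h.ne, h.not_gt]
    · simp [h, this]
    · simp only [h, h.ne', h.not_gt, if_true, if_false, zero_add]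
      rw [← pow_succ', ← pow_add]
      congr 1
      omega
  have hlow : ∑ p ∈ P with e p.1 < e' p.2, B ^ (e p.1 + (K - e' p.2)) < B ^ K := by
    refine lt_of_mul_lt_mul_left (a := B) ?_ hB.le
    calc B * ∑ p ∈ P with e p.1 < e' p.2, B ^ (e p.1 + (K - e' p.2))
        ≤ ∑ p ∈ P with e p.1 < e' p.2, B ^ K := by
          rw [Finset.mul_sum]
          refine Finset.sum_le_sum fun p hp => ?_
          obtain ⟨hp, h⟩ := Finset.mem_filter.mp hp
          have := he' p.2 (Finset.mem_product.mp hp).2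
          rw [← pow_succ']
          exact Nat.pow_le_pow_right hB (by omega)
      _ ≤ P.card * B ^ K := by
          rw [Finset.sum_const, smul_eq_mul]
          exact Nat.mul_le_mul_right _ (Finset.card_filter_le _ _)
      _ < B * B ^ K := by
          rw [hP, Finset.card_product]
          exact Nat.mul_lt_mul_of_pos_right hcard (pow_pos hB K)
  rw [hsplit, Nat.add_mul_div_left _ _ (pow_pos hB K), Nat.div_eq_of_lt hlow, zero_add,
    Nat.add_mul_mod_self_left, Nat.mod_eq_of_lt]
  refine (Finset.card_filter_le _ _).trans_lt ?_
  rwa [hP, Finset.card_product]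

/-- The type of the tuples `(h, e, e', c, d)` that are to satisfy `c ≤ e ≤ h ≤ e' ≤ d`. -/
abbrev Chain : Type := FixedFour × MonotoneFour × MonotoneFour × FixedFour × FixedFour

namespace Chain

/-- The tuples `(h, e, e', c, d)` such that `c ≤ e ≤ h ≤ e' ≤ d` and that `e` lies below `x` and
`e'` above `y`. -/
noncomputable def between (x y : ℕ) : Finset Chain :=
  Finset.univ.filter fun (h, e, e', c, d) =>
    (e.code &&& (h.1.code &&& x) = e.code ∧
      (h.1.code ||| y) &&& e'.code = h.1.code ||| y) ∧
    c.1.code &&& e.code = c.1.code ∧ e'.code &&& d.1.code = e'.code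

theorem mem_between_iff (t : Chain) (p q r s : MonotoneFour) :
    t ∈ between (p.code &&& q.code) (r.code ||| s.code) ↔
      (t.2.1 ≤ t.1.1 ∧ t.2.1 ≤ p ∧ t.2.1 ≤ q) ∧ (t.1.1 ≤ t.2.2.1 ∧ r ≤ t.2.2.1 ∧ s ≤ t.2.2.1) ∧
        t.2.2.2.1.1 ≤ t.2.1 ∧ t.2.2.1 ≤ t.2.2.2.2.1 := by
  simp only [between, Finset.mem_filter_univ, land_land_eq_left_iff, lor_land_eq_left_iff,
    MonotoneFour.code_land_code_eq_iff, and_assoc]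

/-- The position of the two ends of a chain. -/
noncomputable def exponent (t : Chain) : ℕ :=
  28 * rank t.2.2.2.1.1.code + rank t.2.2.2.2.1.code

theorem exponent_le (t : Chain) : exponent t ≤ 783 := by
  have := t.2.2.2.1.rank_le
  have := t.2.2.2.2.rank_le
  unfold exponent
  omega

theorem exponent_eq_iff (s t : Chain) : exponent s = exponent t ↔ s.2.2.2 = t.2.2.2 := by
  constructor
  · intro h
    have := s.2.2.2.2.rank_le
    have := t.2.2.2.2.rank_le
    unfold exponent at h
    exact Prod.ext (FixedFour.rank_injective (show rank _ = rank _ by omega))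
      (FixedFour.rank_injective (show rank _ = rank _ by omega))
  · intro h
    rw [exponent, exponent, h]

theorem card_eq : Fintype.card Chain = 28 ^ 3 * 168 ^ 2 := by
  have h₁ := MonotoneFour.listSum_codes fun _ => 1
  have h₂ := FixedFour.listSum_fixedCodes fun _ => 1
  rw [listSum_eq, List.map_const', List.sum_replicate, Finset.sum_const, Finset.card_univ] at h₁ h₂
  simp only [smul_eq_mul, mul_one] at h₁ h₂
  rw [show codes.length = 168 by decide +kernel] at h₁
  rw [show fixedCodes.length = 28 by decide +kernel] at h₂
  simp only [Fintype.card_prod, ← h₁, ← h₂]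
  norm_num

theorem chainSum_eq (u v : ℕ → ℕ) (x y : ℕ) :
    chainSum u v x y = ∑ t ∈ between x y, u t.2.2.2.1.1.code * v t.2.2.2.2.1.code := by
  simp only [chainSum, force_eq, lowChainSum, highChainSum, lowSum, highSum, ifLe_eq,
    MonotoneFour.listSum_codes, FixedFour.listSum_fixedCodes, between, Finset.sum_filter,
    Fintype.sum_prod_type]
  refine Finset.sum_congr rfl fun h _ => ?_
  refine (Finset.sum_mul_sum _ _ _ _).trans ?_
  refine Finset.sum_congr rfl fun e _ => Finset.sum_congr rfl fun e' _ => ?_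
  change (if e.code &&& (h.1.code &&& x) = e.code then _ else _) *
    (if (h.1.code ||| y) &&& e'.code = h.1.code ||| y then _ else _) = _
  rw [ite_zero_mul_ite_zero, Finset.sum_mul_sum]
  simp only [ite_zero_mul_ite_zero, ite_and]
  split_ifs <;> simp

theorem weight_mul_weight (t : Chain) :
    weight 1792 t.2.2.2.1.1.code * weight 64 t.2.2.2.2.1.code = (2 ^ 64) ^ exponent t := by
  rw [weight_eq, weight_eq, exponent]
  generalize rank t.2.2.2.1.1.code = r, rank t.2.2.2.2.1.code = r'
  rw [← pow_add, ← pow_mul, show 1792 * r + 64 * r' = 64 * (28 * r + r') by ring]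

theorem coweight_mul_coweight (t : Chain) :
    coweight 1792 t.2.2.2.1.1.code * coweight 64 t.2.2.2.2.1.code =
      (2 ^ 64) ^ (783 - exponent t) := by
  have h := t.2.2.2.1.rank_le
  have h' := t.2.2.2.2.rank_le
  rw [coweight_eq, coweight_eq, exponent]
  generalize rank t.2.2.2.1.1.code = r, rank t.2.2.2.2.1.code = r' at h h' ⊢
  rw [← pow_add, ← pow_mul,
    show 1792 * (27 - r) + 64 * (27 - r') = 64 * (783 - (28 * r + r')) by omega]

theorem card_mul_card_lt (S T : Finset Chain) : S.card * T.card < 2 ^ 64 := by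
  have hS := S.card_le_univ
  have hT := T.card_le_univ
  rw [card_eq] at hS hT
  exact (Nat.mul_le_mul hS hT).trans_lt (by norm_num)

theorem sliceCount_eq_card (m n n' : ℕ) :
    sliceCount m n n' =
      ((between (m &&& n') (m ||| n) ×ˢ between (m &&& n) (m ||| n')).filter
        fun p => exponent p.1 = exponent p.2).card := by
  rw [← sum_pow_mul_sum_pow_digit _ _ exponent exponent 783 (2 ^ 64) (fun t _ => exponent_le t)
    (card_mul_card_lt _ _), sliceCount_eq, chainSum_eq, chainSum_eq, Nat.shiftRight_eq_div_pow,
    ← pow_mul]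
  simp only [weight_mul_weight, coweight_mul_coweight]
  rfl

end Chain

/-- The slices that determine a function: those at `(01, 01)` and `(01, 10)`, followed by a chain
below and above the slice at `(00, 11)` and one below and above the slice at `(11, 00)`. -/
abbrev SliceData : Type := {q : MonotoneFour × MonotoneFour × Chain × Chain //
    q.2.2.1 ∈ Chain.between (q.1.code &&& q.2.1.swapPairs.code) (q.1.code ||| q.2.1.code) ∧
    q.2.2.2 ∈ Chain.between (q.1.code &&& q.2.1.code) (q.1.code ||| q.2.1.swapPairs.code) ∧
    q.2.2.1.exponent = q.2.2.2.exponent}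

theorem totalCount_eq_card : totalCount = Nat.card SliceData := by
  classical
  rw [totalCount_eq, Nat.card_eq_fintype_card, Fintype.card_subtype, Finset.card_filter,
    Fintype.sum_prod_type, MonotoneFour.listSum_codes]
  refine Finset.sum_congr rfl fun m _ => ?_
  rw [Fintype.sum_prod_type, MonotoneFour.listSum_codes]
  refine Finset.sum_congr rfl fun n _ => ?_
  rw [MonotoneFour.swapCode_code, Chain.sliceCount_eq_card, ← Finset.card_filter]
  refine congrArg Finset.card (Finset.ext fun p => ?_)
  simp only [Finset.mem_filter, Finset.mem_product, Finset.mem_univ, true_and, and_assoc]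

/-- The permutation `(0 1)(2 3)(4 5)(6 7)`. -/
abbrev pairSwap : Equiv.Perm (Fin 8) :=
  Equiv.swap 0 1 * Equiv.swap 2 3 * Equiv.swap 4 5 * Equiv.swap 6 7

theorem comp_pairSwap (x : Fin 8 → Bool) :
    x ∘ pairSwap = ![x 1, x 0, x 3, x 2, x 5, x 4, x 7, x 6] := by
  funext i
  have H : pairSwap i = ![1, 0, 3, 2, 5, 4, 7, 6] i := by decide +revert
  rw [Function.comp_apply, H]
  fin_cases i <;> rfl

/-- The monotone functions of eight variables that are fixed by `pairSwap`. -/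
abbrev FixedEight : Type :=
  {f : (Fin 8 → Bool) → Bool // Monotone f ∧ ∀ x, f (x ∘ pairSwap) = f x}

namespace FixedEight

/-- The function of the first four variables obtained by fixing the last four. -/
def slice (f : FixedEight) (a b c d : Bool) : MonotoneFour :=
  ⟨fun x => f.1 ![x 0, x 1, x 2, x 3, a, b, c, d], fun x y h => f.2.1 fun i => by
    fin_cases i <;> first | exact h _ | exact le_rfl⟩

theorem swapPairs_slice (f : FixedEight) (a b c d : Bool) :
    (f.slice a b c d).swapPairs = f.slice b a d c := by
  refine Subtype.ext (funext fun x => ?_)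
  change f.1 ![x 1, x 0, x 3, x 2, a, b, c, d] = f.1 ![x 0, x 1, x 2, x 3, b, a, d, c]
  rw [← f.2.2, comp_pairSwap]
  rfl

theorem slice_le_slice (f : FixedEight) {a b c d a' b' c' d' : Bool} (ha : a ≤ a') (hb : b ≤ b')
    (hc : c ≤ c') (hd : d ≤ d') : f.slice a b c d ≤ f.slice a' b' c' d' := fun x =>
  f.2.1 fun i => by
    fin_cases i
    exacts [le_refl (x 0), le_refl (x 1), le_refl (x 2), le_refl (x 3), ha, hb, hc, hd]

theorem ext_slice {f g : FixedEight} (H : ∀ a b c d, f.slice a b c d = g.slice a b c d) :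
    f = g := by
  refine Subtype.ext (funext fun x => ?_)
  have hx : x = ![x 0, x 1, x 2, x 3, x 4, x 5, x 6, x 7] := by
    funext i
    fin_cases i <;> rfl
  have := congrFun (congrArg Subtype.val (H (x 4) (x 5) (x 6) (x 7))) ![x 0, x 1, x 2, x 3]
  rw [hx]
  exact this

/-- The function with given slices. -/
def ofSlices (F : Bool → Bool → Bool → Bool → MonotoneFour)
    (hF : ∀ a b c d, (F a b c d).swapPairs = F b a d c)
    (h₁ : ∀ b c d, F false b c d ≤ F true b c d) (h₂ : ∀ a b d, F a b false d ≤ F a b true d) :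
    FixedEight :=
  ⟨fun x => (F (x 4) (x 5) (x 6) (x 7)).1 ![x 0, x 1, x 2, x 3], by
    have h₃ : ∀ a c d, F a false c d ≤ F a true c d := fun a c d => by
      rw [← hF false a d c, ← hF true a d c]
      exact MonotoneFour.swapPairs_le_swapPairs (h₁ _ _ _)
    have h₄ : ∀ a b c, F a b c false ≤ F a b c true := fun a b c => by
      rw [← hF b a false c, ← hF b a true c]
      exact MonotoneFour.swapPairs_le_swapPairs (h₂ _ _ _)
    constructor
    · intro x y hxy
      have H : F (x 4) (x 5) (x 6) (x 7) ≤ F (y 4) (y 5) (y 6) (y 7) := by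
        have step : ∀ (G : Bool → MonotoneFour), G false ≤ G true → ∀ {a b : Bool}, a ≤ b →
            G a ≤ G b := by
          intro G hG a b hab
          cases a <;> cases b <;> first | exact le_rfl | exact hG | exact absurd hab (by decide)
        exact (step (fun a => F a _ _ _) (h₁ _ _ _) (hxy 4)).trans
          ((step (fun b => F _ b _ _) (h₃ _ _ _) (hxy 5)).trans
          ((step (fun c => F _ _ c _) (h₂ _ _ _) (hxy 6)).trans
          (step (fun d => F _ _ _ d) (h₄ _ _ _) (hxy 7))))
      refine (H _).trans ((F _ _ _ _).2 fun i => ?_)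
      fin_cases i <;> exact hxy _
    · intro x
      simp only [comp_pairSwap]
      change (F (x 5) (x 4) (x 7) (x 6)).1 ![x 1, x 0, x 3, x 2] = _
      rw [← hF]
      rfl⟩

theorem slice_ofSlices (F hF h₁ h₂) (a b c d : Bool) :
    (ofSlices F hF h₁ h₂).slice a b c d = F a b c d := by
  refine Subtype.ext (funext fun x => congrArg (F a b c d).1 (funext fun i => ?_))
  fin_cases i <;> rfl

/-- The slice at fixed values. -/
def fixedSlice (f : FixedEight) (a b : Bool) : FixedFour :=
  ⟨f.slice a a b b, swapPairs_slice _ _ _ _ _⟩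

/-- The slices of a function that are recorded in `SliceData`. -/
def toData (f : FixedEight) : MonotoneFour × MonotoneFour × Chain × Chain :=
  (f.slice false true false true, f.slice false true true false,
    (f.fixedSlice false true, f.slice false false false true, f.slice false true true true,
      f.fixedSlice false false, f.fixedSlice true true),
    (f.fixedSlice true false, f.slice false true false false, f.slice true true false true,
      f.fixedSlice false false, f.fixedSlice true true))

/-- All slices, in terms of those in `toData`. -/
def fromData (q : MonotoneFour × MonotoneFour × Chain × Chain) :
    Bool → Bool → Bool → Bool → MonotoneFour
  | false, false, false, false => q.2.2.1.2.2.2.1.1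
  | false, false, false, true => q.2.2.1.2.1
  | false, false, true, false => q.2.2.1.2.1.swapPairs
  | false, false, true, true => q.2.2.1.1.1
  | false, true, false, false => q.2.2.2.2.1
  | false, true, false, true => q.1
  | false, true, true, false => q.2.1
  | false, true, true, true => q.2.2.1.2.2.1
  | true, false, false, false => q.2.2.2.2.1.swapPairs
  | true, false, false, true => q.2.1.swapPairs
  | true, false, true, false => q.1.swapPairs
  | true, false, true, true => q.2.2.1.2.2.1.swapPairs
  | true, true, false, false => q.2.2.2.1.1
  | true, true, false, true => q.2.2.2.2.2.1
  | true, true, true, false => q.2.2.2.2.2.1.swapPairs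
  | true, true, true, true => q.2.2.1.2.2.2.2.1

theorem fromData_toData (f : FixedEight) (a b c d : Bool) :
    fromData f.toData a b c d = f.slice a b c d := by
  cases a <;> cases b <;> cases c <;> cases d <;> first | rfl | exact swapPairs_slice _ _ _ _ _

theorem toData_ofSlices (F hF h₁ h₂) : (ofSlices F hF h₁ h₂).toData =
    (F false true false true, F false true true false,
      (⟨F false false true true, hF _ _ _ _⟩, F false false false true, F false true true true,
        ⟨F false false false false, hF _ _ _ _⟩, ⟨F true true true true, hF _ _ _ _⟩),
      (⟨F true true false false, hF _ _ _ _⟩, F false true false false, F true true false true,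
        ⟨F false false false false, hF _ _ _ _⟩, ⟨F true true true true, hF _ _ _ _⟩)) := by
  simp only [toData, fixedSlice, slice_ofSlices]

theorem swapPairs_fromData (q) (a b c d : Bool) :
    (fromData q a b c d).swapPairs = fromData q b a d c := by
  cases a <;> cases b <;> cases c <;> cases d <;>
    first | rfl | exact MonotoneFour.swapPairs_swapPairs _ | exact FixedFour.swapPairs_eq _

/-- A function is determined by the slices in `SliceData`. -/
noncomputable def equivSliceData : FixedEight ≃ SliceData := by
  refine Equiv.ofBijective (fun f => ⟨f.toData, ?_⟩) ⟨?_, ?_⟩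
  · simp only [Chain.mem_between_iff, Chain.exponent_eq_iff]
    simp only [toData, swapPairs_slice, fixedSlice, and_true]
    refine ⟨⟨⟨?_, ?_, ?_⟩, ⟨?_, ?_, ?_⟩, ?_, ?_⟩, ⟨?_, ?_, ?_⟩, ⟨?_, ?_, ?_⟩, ?_, ?_⟩ <;>
      exact slice_le_slice _ (by decide) (by decide) (by decide) (by decide)
  · intro f g h
    refine ext_slice fun a b c d => ?_
    rw [← fromData_toData, ← fromData_toData, show f.toData = g.toData from congrArg Subtype.val h]
  · rintro ⟨q, h⟩
    obtain ⟨m, n, ⟨k, e₁, e₄, c, d⟩, k', e₂, e₃, c', d'⟩ := q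
    simp only [Chain.mem_between_iff, Chain.exponent_eq_iff, Prod.mk.injEq] at h
    obtain ⟨⟨⟨a₁, a₂, a₃⟩, ⟨a₄, a₅, a₆⟩, a₇, a₈⟩,
      ⟨⟨b₁, b₂, b₃⟩, ⟨b₄, b₅, b₆⟩, b₇, b₈⟩, rfl, rfl⟩ := h
    refine ⟨ofSlices (fromData (m, n, (k, e₁, e₄, c, d), (k', e₂, e₃, c, d)))
      (swapPairs_fromData _) ?_ ?_, ?_⟩
    · rintro (_ | _) (_ | _) (_ | _)
      exacts [c.le_swapPairs b₇, a₃, MonotoneFour.swapPairs_le_swapPairs a₂, k.le_swapPairs a₄,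
        b₁, b₅, MonotoneFour.le_swapPairs_of_swapPairs_le b₆, a₈]
    · rintro (_ | _) (_ | _) (_ | _)
      exacts [c.le_swapPairs a₇, a₁, b₃, a₅, MonotoneFour.swapPairs_le_swapPairs b₂,
        MonotoneFour.swapPairs_le_swapPairs a₆, k'.le_swapPairs b₄, b₈]
    · exact Subtype.ext (toData_ofSlices _ _ _ _)

end FixedEight

set_option maxRecDepth 100000 in
theorem totalCount_value : totalCount = 2038188253420 := by decide +kernel

/-- The number of monotone Boolean functions of 8 variables fixed by the
permutation (0 1)(2 3)(4 5)(6 7) equals 2038188253420. -/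
theorem card_fixed_mbf :
    Nat.card {f : (Fin 8 → Bool) → Bool //
      Monotone f ∧ ∀ x : Fin 8 → Bool, f (x ∘ (Equiv.swap 0 1 * Equiv.swap 2 3 * Equiv.swap 4 5 * Equiv.swap 6 7 : Equiv.Perm (Fin 8))) = f x} = 2038188253420 := by
  rw [← totalCount_value, totalCount_eq_card]
  exact Nat.card_congr FixedEight.equivSliceData
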